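/- arXiv:1309.5512 — 3 statements merged into one kernel-verified Lean document; each statement's English description precedes it below -/
import Mathlib

section
/- (Backward Darboux transformation for the dKdV equation, Proposition 5.) Let a_1, a_2 be nonzero complex numbers and λ ∈ ℂ. Let τ : ℤ² × ℝ → ℂ be nowhere vanishing, smooth in x, and satisfy the three 2-reduced semi-discrete KP equations: (a_1−a_2)(τ_{12}τ − τ_1τ_2) + τ_{1,x}τ_2 − τ_1τ_{2,x} = 0; (a_1+a_2)(τ_{12̄}τ − τ_1τ_2̄) + τ_{1,x}τ_2̄ − τ_1τ_{2̄,x} = 0; and 2a_2(τ² − τ_2τ_2̄) + τ_{2,x}τ_2̄ − τ_2τ_{2̄,x} = 0, at every lattice point and every x. Set u := τ_1̄τ_2/(τ_{1̄2}τ). Let ρ and ψ be smooth solutions of the dKdV backward Lax system with data (u, τ), with ρ nowhere vanishing. Define τ̃ := ρτ, ũ := u·ρ_1̄ρ_2/(ρ_{1̄2}ρ), and ψ̃ := ψ_x − (ρ_x/ρ)ψ. Then ũ = τ̃_1̄τ̃_2/(τ̃_{1̄2}τ̃), ψ̃ = −a_i(ψ_ī − (ρ_ī/ρ)ψ) for i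 = 1,2, τ̃ satisfies the same three bilinear equations, and ψ̃ satisfies the dKdV backward Lax system with data (ũ, τ̃). -/
noncomputable section

/-- The three 2-reduced semi-discrete KP bilinear equations:
`(a₁−a₂)(τ_{12}τ − τ_1τ_2) + τ_{1,x}τ_2 − τ_1τ_{2,x} = 0`,
`(a₁+a₂)(τ_{12̄}τ − τ_1τ_2̄) + τ_{1,x}τ_2̄ − τ_1τ_{2̄,x} = 0`, and
`2a₂(τ² − τ_2τ_2̄) + τ_{2,x}τ_2̄ − τ_2τ_{2̄,x} = 0`. -/
def Bilin2 (a₁ a₂ : ℂ) (τ : ℤ → ℤ → ℝ → ℂ) : Prop :=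
  ∀ n₁ n₂ : ℤ, ∀ x : ℝ,
    ((a₁ - a₂) * (τ (n₁+1) (n₂+1) x * τ n₁ n₂ x - τ (n₁+1) n₂ x * τ n₁ (n₂+1) x)
      + deriv (τ (n₁+1) n₂) x * τ n₁ (n₂+1) x - τ (n₁+1) n₂ x * deriv (τ n₁ (n₂+1)) x = 0)
    ∧ ((a₁ + a₂) * (τ (n₁+1) (n₂-1) x * τ n₁ n₂ x - τ (n₁+1) n₂ x * τ n₁ (n₂-1) x)
      + deriv (τ (n₁+1) n₂) x * τ n₁ (n₂-1) x - τ (n₁+1) n₂ x * deriv (τ n₁ (n₂-1)) x = 0)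
    ∧ (2 * a₂ * (τ n₁ n₂ x ^ 2 - τ n₁ (n₂+1) x * τ n₁ (n₂-1) x)
      + deriv (τ n₁ (n₂+1)) x * τ n₁ (n₂-1) x - τ n₁ (n₂+1) x * deriv (τ n₁ (n₂-1)) x = 0)

/-- The dKdV forward Lax system for `φ` with data `(u, τ)` and spectral parameter `λ`:
`a₁φ_1 − a₂φ_2 = (a₁−a₂)u_2 φ`; `a₁φ_1 + a₂(1−λ²)φ_2̄ = (a₁+a₂)(1/u)φ`;
`φ_x = a_iφ_i + ((τ_x/τ)_i − τ_x/τ − a_i)φ` for `i = 1,2`; and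
`φ_x = −a₂(1−λ²)φ_2̄ + ((τ_x/τ)_2̄ − τ_x/τ + a₂)φ`. -/
def LaxF (a₁ a₂ lam : ℂ) (u τ φ : ℤ → ℤ → ℝ → ℂ) : Prop :=
  ∀ n₁ n₂ : ℤ, ∀ x : ℝ,
    (a₁ * φ (n₁+1) n₂ x - a₂ * φ n₁ (n₂+1) x = (a₁ - a₂) * u n₁ (n₂+1) x * φ n₁ n₂ x)
    ∧ (a₁ * φ (n₁+1) n₂ x + a₂ * (1 - lam^2) * φ n₁ (n₂-1) x
        = (a₁ + a₂) * (1 / u n₁ n₂ x) * φ n₁ n₂ x)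
    ∧ (deriv (φ n₁ n₂) x = a₁ * φ (n₁+1) n₂ x
        + (deriv (τ (n₁+1) n₂) x / τ (n₁+1) n₂ x
            - deriv (τ n₁ n₂) x / τ n₁ n₂ x - a₁) * φ n₁ n₂ x)
    ∧ (deriv (φ n₁ n₂) x = a₂ * φ n₁ (n₂+1) x
        + (deriv (τ n₁ (n₂+1)) x / τ n₁ (n₂+1) x
            - deriv (τ n₁ n₂) x / τ n₁ n₂ x - a₂) * φ n₁ n₂ x)
    ∧ (deriv (φ n₁ n₂) x = -(a₂ * (1 - lam^2)) * φ n₁ (n₂-1) x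
        + (deriv (τ n₁ (n₂-1)) x / τ n₁ (n₂-1) x
            - deriv (τ n₁ n₂) x / τ n₁ n₂ x + a₂) * φ n₁ n₂ x)

/-- The dKdV backward Lax system for `ψ` with data `(u, τ)` and spectral parameter `λ`:
`a₁ψ_1̄ − a₂ψ_2̄ = (a₁−a₂)u_2̄ ψ`; `a₁ψ_1̄ + a₂(1−λ²)ψ_2 = (a₁+a₂)(1/u)ψ`;
`ψ_x = −a_iψ_ī + ((τ_x/τ)_ī − τ_x/τ + a_i)ψ` for `i = 1,2`; and
`ψ_x = a₂(1−λ²)ψ_2 + ((τ_x/τ)_2 − τ_x/τ − a₂)ψ`. -/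
def LaxB (a₁ a₂ lam : ℂ) (u τ ψ : ℤ → ℤ → ℝ → ℂ) : Prop :=
  ∀ n₁ n₂ : ℤ, ∀ x : ℝ,
    (a₁ * ψ (n₁-1) n₂ x - a₂ * ψ n₁ (n₂-1) x = (a₁ - a₂) * u n₁ (n₂-1) x * ψ n₁ n₂ x)
    ∧ (a₁ * ψ (n₁-1) n₂ x + a₂ * (1 - lam^2) * ψ n₁ (n₂+1) x
        = (a₁ + a₂) * (1 / u n₁ n₂ x) * ψ n₁ n₂ x)
    ∧ (deriv (ψ n₁ n₂) x = -a₁ * ψ (n₁-1) n₂ x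
        + (deriv (τ (n₁-1) n₂) x / τ (n₁-1) n₂ x
            - deriv (τ n₁ n₂) x / τ n₁ n₂ x + a₁) * ψ n₁ n₂ x)
    ∧ (deriv (ψ n₁ n₂) x = -a₂ * ψ n₁ (n₂-1) x
        + (deriv (τ n₁ (n₂-1)) x / τ n₁ (n₂-1) x
            - deriv (τ n₁ n₂) x / τ n₁ n₂ x + a₂) * ψ n₁ n₂ x)
    ∧ (deriv (ψ n₁ n₂) x = a₂ * (1 - lam^2) * ψ n₁ (n₂+1) x
        + (deriv (τ n₁ (n₂+1)) x / τ n₁ (n₂+1) x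
            - deriv (τ n₁ n₂) x / τ n₁ n₂ x - a₂) * ψ n₁ n₂ x)

/-- A gauge step `φ_x = c φ' + …` solved by both `ψ` and `ρ` passes to the Darboux transform
`ψ_x - (ρ_x / ρ) ψ` of `ψ`. -/
lemma deriv_darboux_of_step {ψ ψ' ρ ρ' : ℝ → ℂ} {c : ℂ} {x : ℝ}
    (hψ : DifferentiableAt ℝ ψ x) (hψ' : DifferentiableAt ℝ ψ' x)
    (hρ : DifferentiableAt ℝ ρ x) (hρ' : DifferentiableAt ℝ ρ' x)
    (hρ0 : ρ x ≠ 0) (hρ0' : ρ' x ≠ 0)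
    (h : ∀ y, deriv ψ y - deriv ρ y / ρ y * ψ y = c * (ψ' y - ρ' y / ρ y * ψ y)) :
    deriv (fun y => deriv ψ y - deriv ρ y / ρ y * ψ y) x
      = c * (deriv ψ' x - deriv ρ' x / ρ' x * ψ' x)
        + (deriv ρ' x / ρ' x - c * ρ' x / ρ x) * (deriv ψ x - deriv ρ x / ρ x * ψ x) := by
  have hd : HasDerivAt (fun y => c * (ψ' y - ρ' y / ρ y * ψ y))
      (c * (deriv ψ' x - ((deriv ρ' x * ρ x - ρ' x * deriv ρ x) / ρ x ^ 2 * ψ x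
        + ρ' x / ρ x * deriv ψ x))) x :=
    (hψ'.hasDerivAt.sub
      ((hρ'.hasDerivAt.div hρ.hasDerivAt hρ0).mul hψ.hasDerivAt)).const_mul c
  rw [funext h, hd.deriv, sub_eq_iff_eq_add.mp (h x)]
  field_simp
  ring

/-- The difference of two gauge steps for `ρ` shows that `ρ τ` satisfies a bilinear equation
whenever `ρ` satisfies the linear equation `h`. -/
lemma bilinear_of_steps {r r₁ r₂ r₁₂ t t₁ t₂ t₁₂ dr₁ dr₂ dt dt₁ dt₂ b₁ b₂ c₁ c₂ : ℂ}
    (ht₁ : t₁ ≠ 0) (ht₂ : t₂ ≠ 0)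
    (h₁ : dr₁ = -c₁ * r + (dt / t - dt₁ / t₁ + b₁) * r₁)
    (h₂ : dr₂ = -c₂ * r + (dt / t - dt₂ / t₂ + b₂) * r₂)
    (h : (b₁ - b₂) * (t₁₂ * t) * r₁₂ = (c₁ * r₂ - c₂ * r₁) * (t₁ * t₂)) :
    (b₁ - b₂) * (r₁₂ * t₁₂ * (r * t) - r₁ * t₁ * (r₂ * t₂))
      + (dr₁ * t₁ + r₁ * dt₁) * (r₂ * t₂) - r₁ * t₁ * (dr₂ * t₂ + r₂ * dt₂) = 0 := by
  have e₁ : dr₁ * t₁ + r₁ * dt₁ = t₁ * (-c₁ * r + (dt / t + b₁) * r₁) := by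
    linear_combination t₁ * h₁ - r₁ * div_mul_cancel₀ dt₁ ht₁
  have e₂ : dr₂ * t₂ + r₂ * dt₂ = t₂ * (-c₂ * r + (dt / t + b₂) * r₂) := by
    linear_combination t₂ * h₂ - r₂ * div_mul_cancel₀ dt₂ ht₂
  linear_combination r₂ * t₂ * e₁ - r₁ * t₁ * e₂ + r * h

/-- Subtracting the gauge steps of `ψ` and `ρ` eliminates the potential. -/
lemma darboux_eq_of_steps {p p' r r' dp dr c q : ℂ} (hr : r ≠ 0)
    (hp : dp = c * p' + q * p) (hq : dr = c * r' + q * r) :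
    dp - dr / r * p = c * (p' - r' / r * p) := by
  rw [hp, hq]
  field_simp
  ring

/-- The three-point linear equation for `ρ`, with coefficient `k`, passes to the Darboux
transform `w` of `p`, where `w₁` and `w₂` are its two shifts. -/
lemma linear_darboux_of_steps {p p₁ p₂ p₁₂ r r₁ r₂ r₁₂ w w₁ w₂ c₁ c₂ k : ℂ}
    (hr : r ≠ 0) (hr₁ : r₁ ≠ 0) (hr₂ : r₂ ≠ 0)
    (h₁ : w = c₁ * (p₁ - r₁ / r * p)) (h₂ : w = c₂ * (p₂ - r₂ / r * p))
    (hw₁ : w₁ = c₂ * (p₁₂ - r₁₂ / r₁ * p₁)) (hw₂ : w₂ = c₁ * (p₁₂ - r₁₂ / r₂ * p₂))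
    (h : c₁ * r₁ - c₂ * r₂ = k * r) :
    c₁ * w₁ - c₂ * w₂ = k * (r₁₂ * r / (r₁ * r₂)) * w := by
  have e₁ : c₁ * (p₁ / r₁) = w / r₁ + c₁ * (p / r) := by
    rw [h₁]; field_simp; ring
  have e₂ : c₂ * (p₂ / r₂) = w / r₂ + c₂ * (p / r) := by
    rw [h₂]; field_simp; ring
  have e : k * (r₁₂ * r / (r₁ * r₂)) * w = r₁₂ * w * (c₁ / r₂ - c₂ / r₁) := by
    rw [show k * (r₁₂ * r / (r₁ * r₂)) * w = (k * r) * (r₁₂ * w / (r₁ * r₂)) by ring, ← h]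
    field_simp
  rw [e, hw₁, hw₂]
  linear_combination (-c₂ * r₁₂) * e₁ + (c₁ * r₁₂) * e₂

/-- The logarithmic derivative of a product turns the derivative of a Darboux transform
into the gauge step for the new potential. -/
lemma step_of_deriv_darboux {dw w w' r r' t t' dr dr' dt dt' c b : ℂ}
    (hr : r ≠ 0) (hr' : r' ≠ 0) (ht : t ≠ 0) (ht' : t' ≠ 0)
    (h : dr = c * r' + (dt' / t' - dt / t + b) * r)
    (hd : dw = c * w' + (dr' / r' - c * r' / r) * w) :
    dw = c * w' + ((dr' * t' + r' * dt') / (r' * t') - (dr * t + r * dt) / (r * t) + b) * w := by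
  rw [hd, h]
  field_simp
  ring

/-- Backward Darboux transformation for the dKdV equation (Proposition 5): with `τ` nowhere
vanishing solving the three 2-reduced bilinear equations, `u = τ_1̄τ_2/(τ_{1̄2}τ)`, and
`ρ, ψ` solutions of the dKdV backward Lax system with data `(u, τ)`, `ρ` nowhere zero, the
functions `τ̃ = ρτ`, `ũ = u·ρ_1̄ρ_2/(ρ_{1̄2}ρ)` and `ψ̃ = ψ_x − (ρ_x/ρ)ψ` satisfy:
`ũ = τ̃_1̄τ̃_2/(τ̃_{1̄2}τ̃)`; `ψ̃ = −a_i(ψ_ī − (ρ_ī/ρ)ψ)` for `i = 1,2`; `τ̃` solves the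
same three bilinear equations; and `ψ̃` solves the dKdV backward Lax system with data
`(ũ, τ̃)`. -/
theorem backward_darboux_dKdV
    (a₁ a₂ lam : ℂ) (ha₁ : a₁ ≠ 0) (ha₂ : a₂ ≠ 0)
    (τ ρ ψ : ℤ → ℤ → ℝ → ℂ)
    (hτ0 : ∀ n₁ n₂ x, τ n₁ n₂ x ≠ 0)
    (hτsmooth : ∀ n₁ n₂, ContDiff ℝ (⊤ : ℕ∞) (τ n₁ n₂))
    (hτbil : Bilin2 a₁ a₂ τ)
    (hρsmooth : ∀ n₁ n₂, ContDiff ℝ (⊤ : ℕ∞) (ρ n₁ n₂))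
    (hψsmooth : ∀ n₁ n₂, ContDiff ℝ (⊤ : ℕ∞) (ψ n₁ n₂))
    (hρ : LaxB a₁ a₂ lam
      (fun n₁ n₂ x => τ (n₁-1) n₂ x * τ n₁ (n₂+1) x / (τ (n₁-1) (n₂+1) x * τ n₁ n₂ x)) τ ρ)
    (hψ : LaxB a₁ a₂ lam
      (fun n₁ n₂ x => τ (n₁-1) n₂ x * τ n₁ (n₂+1) x / (τ (n₁-1) (n₂+1) x * τ n₁ n₂ x)) τ ψ)
    (hρ0 : ∀ n₁ n₂ x, ρ n₁ n₂ x ≠ 0) :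
    (∀ n₁ n₂ : ℤ, ∀ x : ℝ,
      τ (n₁-1) n₂ x * τ n₁ (n₂+1) x / (τ (n₁-1) (n₂+1) x * τ n₁ n₂ x)
          * (ρ (n₁-1) n₂ x * ρ n₁ (n₂+1) x / (ρ (n₁-1) (n₂+1) x * ρ n₁ n₂ x))
        = (ρ (n₁-1) n₂ x * τ (n₁-1) n₂ x) * (ρ n₁ (n₂+1) x * τ n₁ (n₂+1) x)
            / ((ρ (n₁-1) (n₂+1) x * τ (n₁-1) (n₂+1) x) * (ρ n₁ n₂ x * τ n₁ n₂ x)))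
    ∧ (∀ n₁ n₂ : ℤ, ∀ x : ℝ,
      deriv (ψ n₁ n₂) x - deriv (ρ n₁ n₂) x / ρ n₁ n₂ x * ψ n₁ n₂ x
        = -a₁ * (ψ (n₁-1) n₂ x - ρ (n₁-1) n₂ x / ρ n₁ n₂ x * ψ n₁ n₂ x)
      ∧ deriv (ψ n₁ n₂) x - deriv (ρ n₁ n₂) x / ρ n₁ n₂ x * ψ n₁ n₂ x
        = -a₂ * (ψ n₁ (n₂-1) x - ρ n₁ (n₂-1) x / ρ n₁ n₂ x * ψ n₁ n₂ x))
    ∧ Bilin2 a₁ a₂ (fun n₁ n₂ x => ρ n₁ n₂ x * τ n₁ n₂ x)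
    ∧ LaxB a₁ a₂ lam
        (fun n₁ n₂ x =>
          τ (n₁-1) n₂ x * τ n₁ (n₂+1) x / (τ (n₁-1) (n₂+1) x * τ n₁ n₂ x)
            * (ρ (n₁-1) n₂ x * ρ n₁ (n₂+1) x / (ρ (n₁-1) (n₂+1) x * ρ n₁ n₂ x)))
        (fun n₁ n₂ x => ρ n₁ n₂ x * τ n₁ n₂ x)
        (fun n₁ n₂ x =>
          deriv (ψ n₁ n₂) x - deriv (ρ n₁ n₂) x / ρ n₁ n₂ x * ψ n₁ n₂ x) := by
  have hτd n₁ n₂ x : DifferentiableAt ℝ (τ n₁ n₂) x :=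
    (hτsmooth n₁ n₂).differentiable (by simp) x
  have hρd n₁ n₂ x : DifferentiableAt ℝ (ρ n₁ n₂) x :=
    (hρsmooth n₁ n₂).differentiable (by simp) x
  have hψd n₁ n₂ x : DifferentiableAt ℝ (ψ n₁ n₂) x :=
    (hψsmooth n₁ n₂).differentiable (by simp) x
  have hprod n₁ n₂ x : deriv (fun y => ρ n₁ n₂ y * τ n₁ n₂ y) x
      = deriv (ρ n₁ n₂) x * τ n₁ n₂ x + ρ n₁ n₂ x * deriv (τ n₁ n₂) x :=
    ((hρd n₁ n₂ x).hasDerivAt.mul (hτd n₁ n₂ x).hasDerivAt).deriv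
  have hstep₁ n₁ n₂ x : deriv (ψ n₁ n₂) x - deriv (ρ n₁ n₂) x / ρ n₁ n₂ x * ψ n₁ n₂ x
      = -a₁ * (ψ (n₁-1) n₂ x - ρ (n₁-1) n₂ x / ρ n₁ n₂ x * ψ n₁ n₂ x) :=
    darboux_eq_of_steps (hρ0 _ _ _) (hψ n₁ n₂ x).2.2.1 (hρ n₁ n₂ x).2.2.1
  have hstep₂ n₁ n₂ x : deriv (ψ n₁ n₂) x - deriv (ρ n₁ n₂) x / ρ n₁ n₂ x * ψ n₁ n₂ x
      = -a₂ * (ψ n₁ (n₂-1) x - ρ n₁ (n₂-1) x / ρ n₁ n₂ x * ψ n₁ n₂ x) :=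
    darboux_eq_of_steps (hρ0 _ _ _) (hψ n₁ n₂ x).2.2.2.1 (hρ n₁ n₂ x).2.2.2.1
  have hstep₃ n₁ n₂ x : deriv (ψ n₁ n₂) x - deriv (ρ n₁ n₂) x / ρ n₁ n₂ x * ψ n₁ n₂ x
      = a₂ * (1 - lam^2) * (ψ n₁ (n₂+1) x - ρ n₁ (n₂+1) x / ρ n₁ n₂ x * ψ n₁ n₂ x) :=
    darboux_eq_of_steps (q := deriv (τ n₁ (n₂+1)) x / τ n₁ (n₂+1) x
      - deriv (τ n₁ n₂) x / τ n₁ n₂ x - a₂) (hρ0 _ _ _)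
      (hψ n₁ n₂ x).2.2.2.2 (hρ n₁ n₂ x).2.2.2.2
  refine ⟨fun n₁ n₂ x => ?_, fun n₁ n₂ x => ⟨hstep₁ n₁ n₂ x, hstep₂ n₁ n₂ x⟩,
    fun n₁ n₂ x => ?_, fun n₁ n₂ x => ?_⟩
  · rw [div_mul_div_comm]
    congr 1 <;> ring
  · have s₁ := (hρ (n₁+1) n₂ x).2.2.1
    have s₂ := (hρ n₁ (n₂+1) x).2.2.2.1
    have s₃ := (hρ n₁ (n₂-1) x).2.2.2.2
    have l₁ := (hρ (n₁+1) (n₂+1) x).1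
    have l₂ := (hρ (n₁+1) (n₂-1) x).2.1
    have m₁ := (hρ n₁ n₂ x).2.2.2.1
    have m₂ := (hρ n₁ n₂ x).2.2.2.2
    have b₃ := (hτbil n₁ n₂ x).2.2
    simp only [add_sub_cancel_right, sub_add_cancel] at s₁ s₂ s₃ l₁ l₂
    have ht := hτ0 n₁ n₂ x
    have ht₁ := hτ0 (n₁+1) n₂ x
    have ht₂ := hτ0 n₁ (n₂+1) x
    have ht₂' := hτ0 n₁ (n₂-1) x
    have ht₁₂ := hτ0 (n₁+1) (n₂+1) x
    have ht₁₂' := hτ0 (n₁+1) (n₂-1) x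
    have s₃' : deriv (ρ n₁ (n₂-1)) x = -(-(a₂ * (1 - lam^2))) * ρ n₁ n₂ x
        + (deriv (τ n₁ n₂) x / τ n₁ n₂ x
            - deriv (τ n₁ (n₂-1)) x / τ n₁ (n₂-1) x + -a₂) * ρ n₁ (n₂-1) x := by
      linear_combination s₃
    simp only [hprod]
    refine ⟨bilinear_of_steps ht₁ ht₂ s₁ s₂ ?_, ?_, ?_⟩
    · rw [l₁]
      field_simp
    · rw [← sub_neg_eq_add a₁ a₂]
      refine bilinear_of_steps ht₁ ht₂' s₁ s₃' ?_
      rw [neg_mul, sub_neg_eq_add, sub_neg_eq_add, l₂]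
      field_simp
    · have h := bilinear_of_steps (r₁₂ := ρ n₁ n₂ x) (t₁₂ := τ n₁ n₂ x) ht₂ ht₂' s₂ s₃' (by
        have hm : a₂ * ρ n₁ (n₂-1) x + a₂ * (1 - lam^2) * ρ n₁ (n₂+1) x
            = (2 * a₂ + deriv (τ n₁ (n₂-1)) x / τ n₁ (n₂-1) x
              - deriv (τ n₁ (n₂+1)) x / τ n₁ (n₂+1) x) * ρ n₁ n₂ x := by
          linear_combination m₁ - m₂
        rw [neg_mul, sub_neg_eq_add, sub_neg_eq_add, hm]
        field_simp
        linear_combination ρ n₁ n₂ x * b₃)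
      linear_combination h
  · have g₁ := hstep₂ (n₁-1) n₂ x
    have g₂ := hstep₁ n₁ (n₂-1) x
    have g₃ := hstep₃ (n₁-1) n₂ x
    have g₄ := hstep₁ n₁ (n₂+1) x
    have l₁ := (hρ n₁ n₂ x).1
    have l₂ := (hρ n₁ n₂ x).2.1
    have hr := hρ0 n₁ n₂ x
    simp only [sub_add_cancel, hprod] at l₁ l₂ ⊢
    refine ⟨?_, ?_, ?_, ?_, ?_⟩
    · have h := linear_darboux_of_steps hr (hρ0 _ _ _) (hρ0 _ _ _) (hstep₁ n₁ n₂ x)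
        (hstep₂ n₁ n₂ x) g₁ g₂
        (k := -((a₁ - a₂) * (τ (n₁-1) (n₂-1) x * τ n₁ n₂ x / (τ (n₁-1) n₂ x * τ n₁ (n₂-1) x))))
        (by linear_combination -l₁)
      linear_combination -h
    · have h := linear_darboux_of_steps hr (hρ0 _ _ _) (hρ0 _ _ _) (hstep₁ n₁ n₂ x)
        (hstep₃ n₁ n₂ x) g₃ g₄
        (k := -((a₁ + a₂) *
          (1 / (τ (n₁-1) n₂ x * τ n₁ (n₂+1) x / (τ (n₁-1) (n₂+1) x * τ n₁ n₂ x)))))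
        (by linear_combination -l₂)
      rw [one_div, mul_inv, inv_div (ρ (n₁-1) n₂ x * ρ n₁ (n₂+1) x)]
      linear_combination -h
    · exact step_of_deriv_darboux hr (hρ0 _ _ _) (hτ0 _ _ _) (hτ0 _ _ _) (hρ n₁ n₂ x).2.2.1
        (deriv_darboux_of_step (hψd _ _ _) (hψd _ _ _) (hρd _ _ _) (hρd _ _ _) hr (hρ0 _ _ _)
          (hstep₁ n₁ n₂))
    · exact step_of_deriv_darboux hr (hρ0 _ _ _) (hτ0 _ _ _) (hτ0 _ _ _) (hρ n₁ n₂ x).2.2.2.1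
        (deriv_darboux_of_step (hψd _ _ _) (hψd _ _ _) (hρd _ _ _) (hρd _ _ _) hr (hρ0 _ _ _)
          (hstep₂ n₁ n₂))
    · have hs : deriv (ρ n₁ n₂) x = a₂ * (1 - lam^2) * ρ n₁ (n₂+1) x
          + (deriv (τ n₁ (n₂+1)) x / τ n₁ (n₂+1) x
            - deriv (τ n₁ n₂) x / τ n₁ n₂ x + -a₂) * ρ n₁ n₂ x := by
        linear_combination (hρ n₁ n₂ x).2.2.2.2
      have h := step_of_deriv_darboux hr (hρ0 _ _ _) (hτ0 _ _ _) (hτ0 _ _ _) hs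
        (deriv_darboux_of_step (hψd _ _ _) (hψd _ _ _) (hρd _ _ _) (hρd _ _ _) hr (hρ0 _ _ _)
          (hstep₃ n₁ n₂))
      linear_combination h
end
end

section
/- (Elimination: from the dKdV/dpKdV Miura-type relations to both equations.) Let a_1, a_2 be complex numbers with a_1² ≠ a_2², let u : ℤ² → ℂ be nowhere zero and v : ℤ² → ℂ, and suppose that at every lattice point (a_1 − a_2)u_2 = v_2 − v_1 + a_1 − a_2 and (a_1 + a_2)(1/u) = v_2̄ − v_1 + a_1 + a_2. Then: (a) v satisfies the dpKdV equation (v_2 − v_1 + a_1 − a_2)(v − v_{12} + a_1 + a_2) = a_1² − a_2² at every lattice point; and (b) u satisfies the dKdV equation 1/u_1 − 1/u_2 = ((a_1 − a_2)/(a_1 + a_2))(u_{12} − u) at every lattice point. -/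
noncomputable section

/-- Elimination: from the dKdV/dpKdV Miura-type relations
`(a₁ − a₂)u_2 = v_2 − v_1 + a₁ − a₂` and `(a₁ + a₂)(1/u) = v_2̄ − v_1 + a₁ + a₂`,
with `u` nowhere zero and `a₁² ≠ a₂²`, it follows that (a) `v` satisfies the dpKdV equation
`(v_2 − v_1 + a₁ − a₂)(v − v_{12} + a₁ + a₂) = a₁² − a₂²` and (b) `u` satisfies the dKdV
equation `1/u_1 − 1/u_2 = ((a₁ − a₂)/(a₁ + a₂))(u_{12} − u)`. -/
theorem dKdV_dpKdV_elimination
    (a₁ a₂ : ℂ) (ha : a₁ ^ 2 ≠ a₂ ^ 2)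
    (u v : ℤ → ℤ → ℂ) (hu0 : ∀ n₁ n₂, u n₁ n₂ ≠ 0)
    (h1 : ∀ n₁ n₂ : ℤ,
      (a₁ - a₂) * u n₁ (n₂ + 1) = v n₁ (n₂ + 1) - v (n₁ + 1) n₂ + a₁ - a₂)
    (h2 : ∀ n₁ n₂ : ℤ,
      (a₁ + a₂) * (1 / u n₁ n₂) = v n₁ (n₂ - 1) - v (n₁ + 1) n₂ + a₁ + a₂) :
    (∀ n₁ n₂ : ℤ,
      (v n₁ (n₂ + 1) - v (n₁ + 1) n₂ + a₁ - a₂)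
          * (v n₁ n₂ - v (n₁ + 1) (n₂ + 1) + a₁ + a₂) = a₁ ^ 2 - a₂ ^ 2)
    ∧ (∀ n₁ n₂ : ℤ,
      1 / u (n₁ + 1) n₂ - 1 / u n₁ (n₂ + 1)
        = (a₁ - a₂) / (a₁ + a₂) * (u (n₁ + 1) (n₂ + 1) - u n₁ n₂)) := by
  have hadd : a₁ + a₂ ≠ 0 := fun h => ha (by linear_combination (a₁ - a₂) * h)
  constructor
  · intro n₁ n₂
    have e1 := h1 n₁ n₂
    have e2 := h2 n₁ (n₂ + 1)
    rw [add_sub_cancel_right] at e2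
    rw [← e1, ← e2]
    have hu := hu0 n₁ (n₂ + 1)
    field_simp
    ring
  · intro n₁ n₂
    have e1 := h1 (n₁ + 1) n₂
    have e2 := h1 n₁ (n₂ - 1)
    have e3 := h2 (n₁ + 1) n₂
    have e4 := h2 n₁ (n₂ + 1)
    rw [sub_add_cancel] at e2
    rw [add_sub_cancel_right] at e4
    rw [div_mul_eq_mul_div, eq_div_iff hadd]
    linear_combination e3 - e4 - e1 + e2
end
end

section
/- (Darboux transformation for the dpKdV equation.) Let a_1, a_2 be nonzero complex numbers with a_1² ≠ a_2² and λ ∈ ℂ. Let v : ℤ² × ℝ → ℂ be smooth in x and satisfy the dpKdV equation (v_2 − v_1 + a_1 − a_2)(v − v_{12} + a_1 + a_2) = a_1² − a_2² at every lattice point and every x. Let θ : ℤ² × ℝ → ℂ be nowhere vanishing, smooth in x, and satisfy: a_1θ_1 − a_2θ_2 = (v_2 − v_1 + a_1 − a_2)θ; a_1θ_1 + a_2(1−λ²)θ_2̄ = (v_2̄ − v_1 + a_1 + a_2)θ; θ_x = a_iθ_i + (v_i − v − a_i)θ for i = 1,2; and θ_x = −a_2(1−λ²)θ_2̄ + (v_2̄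 − v + a_2)θ. Then ṽ := v + θ_x/θ satisfies the dpKdV equation at every lattice point and every x. -/
noncomputable section

/-- The discrete potential KdV (dpKdV) equation
`(v_2 − v_1 + a₁ − a₂)(v − v_{12} + a₁ + a₂) = a₁² − a₂²`, at every lattice point and
every `x`. -/
def dpKdV (a₁ a₂ : ℂ) (v : ℤ → ℤ → ℝ → ℂ) : Prop :=
  ∀ n₁ n₂ : ℤ, ∀ x : ℝ,
    (v n₁ (n₂ + 1) x - v (n₁ + 1) n₂ x + a₁ - a₂)
      * (v n₁ n₂ x - v (n₁ + 1) (n₂ + 1) x + a₁ + a₂) = a₁ ^ 2 - a₂ ^ 2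

/-- Darboux transformation for the dpKdV equation: if `v` solves dpKdV and `θ` is a
nowhere-vanishing solution of the Lax system
`a₁θ_1 − a₂θ_2 = (v_2 − v_1 + a₁ − a₂)θ`,
`a₁θ_1 + a₂(1−λ²)θ_2̄ = (v_2̄ − v_1 + a₁ + a₂)θ`,
`θ_x = a_iθ_i + (v_i − v − a_i)θ` for `i = 1,2`, and
`θ_x = −a₂(1−λ²)θ_2̄ + (v_2̄ − v + a₂)θ`, then `ṽ = v + θ_x/θ` solves the dpKdV
equation. -/
theorem darboux_dpKdV
    (a₁ a₂ lam : ℂ) (ha₁ : a₁ ≠ 0) (ha₂ : a₂ ≠ 0) (ha : a₁ ^ 2 ≠ a₂ ^ 2)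
    (v θ : ℤ → ℤ → ℝ → ℂ)
    (hvsmooth : ∀ n₁ n₂, ContDiff ℝ (⊤ : ℕ∞) (v n₁ n₂))
    (hv : dpKdV a₁ a₂ v)
    (hθ0 : ∀ n₁ n₂ x, θ n₁ n₂ x ≠ 0)
    (hθsmooth : ∀ n₁ n₂, ContDiff ℝ (⊤ : ℕ∞) (θ n₁ n₂))
    (hθ1 : ∀ n₁ n₂ : ℤ, ∀ x : ℝ,
      a₁ * θ (n₁ + 1) n₂ x - a₂ * θ n₁ (n₂ + 1) x
        = (v n₁ (n₂ + 1) x - v (n₁ + 1) n₂ x + a₁ - a₂) * θ n₁ n₂ x)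
    (hθ2 : ∀ n₁ n₂ : ℤ, ∀ x : ℝ,
      a₁ * θ (n₁ + 1) n₂ x + a₂ * (1 - lam ^ 2) * θ n₁ (n₂ - 1) x
        = (v n₁ (n₂ - 1) x - v (n₁ + 1) n₂ x + a₁ + a₂) * θ n₁ n₂ x)
    (hθx1 : ∀ n₁ n₂ : ℤ, ∀ x : ℝ,
      deriv (θ n₁ n₂) x
        = a₁ * θ (n₁ + 1) n₂ x + (v (n₁ + 1) n₂ x - v n₁ n₂ x - a₁) * θ n₁ n₂ x)
    (hθx2 : ∀ n₁ n₂ : ℤ, ∀ x : ℝ,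
      deriv (θ n₁ n₂) x
        = a₂ * θ n₁ (n₂ + 1) x + (v n₁ (n₂ + 1) x - v n₁ n₂ x - a₂) * θ n₁ n₂ x)
    (hθx3 : ∀ n₁ n₂ : ℤ, ∀ x : ℝ,
      deriv (θ n₁ n₂) x
        = -(a₂ * (1 - lam ^ 2)) * θ n₁ (n₂ - 1) x
          + (v n₁ (n₂ - 1) x - v n₁ n₂ x + a₂) * θ n₁ n₂ x) :
    dpKdV a₁ a₂ (fun n₁ n₂ x => v n₁ n₂ x + deriv (θ n₁ n₂) x / θ n₁ n₂ x) := by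
  intro n₁ n₂ x
  have hback := hθ2 n₁ (n₂ + 1) x
  have hx12 := hθx3 (n₁ + 1) (n₂ + 1) x
  rw [add_sub_cancel_right] at hback hx12
  have h := hθ0 n₁ n₂ x
  have h1 := hθ0 (n₁ + 1) n₂ x
  have h2 := hθ0 n₁ (n₂ + 1) x
  have h12 := hθ0 (n₁ + 1) (n₂ + 1) x
  have hA : v n₁ (n₂ + 1) x + deriv (θ n₁ (n₂ + 1)) x / θ n₁ (n₂ + 1) x
        - (v (n₁ + 1) n₂ x + deriv (θ (n₁ + 1) n₂) x / θ (n₁ + 1) n₂ x) + a₁ - a₂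
      = θ (n₁ + 1) (n₂ + 1) x * ((v n₁ (n₂ + 1) x - v (n₁ + 1) n₂ x + a₁ - a₂) * θ n₁ n₂ x)
        / (θ (n₁ + 1) n₂ x * θ n₁ (n₂ + 1) x) := by
    rw [← hθ1, hθx1 n₁ (n₂ + 1), hθx2 (n₁ + 1) n₂]
    field_simp
    ring
  have hB : v n₁ n₂ x + deriv (θ n₁ n₂) x / θ n₁ n₂ x
        - (v (n₁ + 1) (n₂ + 1) x
          + deriv (θ (n₁ + 1) (n₂ + 1)) x / θ (n₁ + 1) (n₂ + 1) x) + a₁ + a₂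
      = θ (n₁ + 1) n₂ x
        * ((v n₁ n₂ x - v (n₁ + 1) (n₂ + 1) x + a₁ + a₂) * θ n₁ (n₂ + 1) x)
        / (θ n₁ n₂ x * θ (n₁ + 1) (n₂ + 1) x) := by
    rw [← hback, hθx1 n₁ n₂, hx12]
    field_simp
    ring
  simp only [hA, hB, ← hv n₁ n₂ x]
  field_simp
end
end
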